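/- arXiv:2205.08793 — 2 statements merged into one kernel-verified Lean document; each statement's English description precedes it below -/
import Mathlib

section
/- For all integers n ≥ 1 and 1 ≤ i, j ≤ n: the number of words w ∈ {0,1}^n such that card_w(i) = j, divided by 2^n, equals a(i,j,n). Equivalently, under the uniform distribution on {0,1}^n, the probability that position i receives card number j after one riffle shuffle is (1/2^i)·C(i−1, j−1) + (1/2^{n−i+1})·C(n−i, j−i). -/
open Finset

/-- `a n i j` : probability that the card in position `i` is number `j` after one
riffle shuffle of a deck `1, …, n`. -/
noncomputable def a (n i j : ℕ) : ℝ :=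
  (1 / 2 ^ i) * (Nat.choose (i - 1) (j - 1) : ℝ) +
    (1 / 2 ^ (n - i + 1)) * (if i ≤ j then (Nat.choose (n - i) (j - i) : ℝ) else 0)

/-- Given a word `w ∈ {0,1}^n` encoding a riffle shuffle (`false` = top pile,
`true` = bottom pile), `cardAt n w p` is the number of the card placed in
position `p` (0-indexed position `p`, i.e. 1-indexed position `p+1`). -/
def cardAt (n : ℕ) (w : Fin n → Bool) (p : Fin n) : ℕ :=
  if w p = false then
    (Finset.univ.filter fun l : Fin n => l ≤ p ∧ w l = false).card
  else
    (Finset.univ.filter fun l : Fin n => w l = false).card +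
      (Finset.univ.filter fun l : Fin n => l ≤ p ∧ w l = true).card

theorem card_filter_forall_mem_eq {ι : Type*} [Fintype ι] [DecidableEq ι]
    (s : Finset ι) (v : ι → Bool) :
    #{w : ι → Bool | ∀ l ∈ s, w l = v l} = 2 ^ (Fintype.card ι - #s) := by
  have h : ({w : ι → Bool | ∀ l ∈ s, w l = v l} : Finset (ι → Bool)) =
      Fintype.piFinset fun l => if l ∈ s then {v l} else univ := by
    ext w
    simp only [mem_filter, mem_univ, true_and, Fintype.mem_piFinset]
    refine forall_congr' fun l => ?_
    split_ifs with hl <;> simp [hl]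
  have hc (l : ι) : #(if l ∈ s then {v l} else univ : Finset Bool) = if l ∈ s then 1 else 2 := by
    split_ifs <;> simp
  rw [h, Fintype.card_piFinset, ← card_compl]
  simp only [hc, prod_ite, prod_const, one_pow, one_mul]
  congr 2
  ext l
  simp

theorem card_filter_apply_eq_and_card_eq {ι : Type*} [Fintype ι] [DecidableEq ι]
    {s : Finset ι} {p : ι} (hp : p ∉ s) (b : Bool) (k : ℕ) :
    #{w : ι → Bool | w p = b ∧ #{l ∈ s | w l = false} = k} =
      (#s).choose k * 2 ^ (Fintype.card ι - (#s + 1)) := by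
  rw [card_eq_sum_card_fiberwise (f := fun w => {l ∈ s | w l = false}) (t := powersetCard k s)]
  · rw [sum_const_nat (m := 2 ^ (Fintype.card ι - (#s + 1))), card_powersetCard]
    intro A hA
    rw [mem_powersetCard] at hA
    rw [← card_insert_of_notMem hp,
      ← card_filter_forall_mem_eq (insert p s) fun l => if l = p then b else decide (l ∉ A)]
    congr 1
    ext w
    simp only [mem_filter, mem_univ, true_and, forall_mem_insert, if_true]
    constructor
    · rintro ⟨⟨hb, -⟩, rfl⟩
      refine ⟨hb, fun l hl => ?_⟩
      have : l ≠ p := ne_of_mem_of_not_mem hl hp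
      simp [this, hl]
    · rintro ⟨hb, hw⟩
      have hf : ({l ∈ s | w l = false} : Finset ι) = A := by
        ext l
        rw [mem_filter]
        constructor
        · rintro ⟨hl, h⟩
          have : l ≠ p := ne_of_mem_of_not_mem hl hp
          simpa [hw l hl, this] using h
        · intro h
          have hl := hA.1 h
          have : l ≠ p := ne_of_mem_of_not_mem hl hp
          exact ⟨hl, by simp [hw l hl, this, h]⟩
      exact ⟨⟨hb, by rw [hf, hA.2]⟩, hf⟩
  · intro w hw
    simp only [coe_filter, mem_univ, true_and, Set.mem_ofPred_eq] at hw
    simp [mem_powersetCard, hw.2]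

theorem cardAt_of_eq_false {n : ℕ} {w : Fin n → Bool} {p : Fin n} (h : w p = false) :
    cardAt n w p = #{l ∈ Iio p | w l = false} + 1 := by
  rw [cardAt, if_pos h, ← card_insert_of_notMem (a := p) (by simp)]
  congr 1
  ext l
  simp only [mem_filter, mem_univ, true_and, mem_insert, mem_Iio, le_iff_eq_or_lt]
  grind

theorem cardAt_of_eq_true {n : ℕ} {w : Fin n → Bool} {p : Fin n} (h : w p = true) :
    cardAt n w p = #{l ∈ Ioi p | w l = false} + (p + 1) := by
  have h1 : #{l : Fin n | w l = false} =
      #{l ∈ Ioi p | w l = false} + #{l ∈ Iic p | w l = false} := by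
    rw [← card_union_of_disjoint]
    · congr 1
      ext l
      simp only [mem_filter, mem_univ, true_and, mem_union, mem_Ioi, mem_Iic]
      grind
    · rw [disjoint_left]
      simp only [mem_filter, mem_Ioi, mem_Iic]
      grind
  have h2 : ({l : Fin n | l ≤ p ∧ w l = true} : Finset (Fin n)) =
      {l ∈ Iic p | ¬ w l = false} := by
    ext l
    simp
  rw [cardAt, if_neg (by simp [h]), h1, h2, add_assoc, card_filter_add_card_filter_not,
    Fin.card_Iic]

/-- Under the uniform distribution on words `w ∈ {0,1}^n`, the probability that
position `i` receives card number `j` after one riffle shuffle equals `a(i,j,n)`. -/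
theorem riffle_prob (n : ℕ) (hn : 1 ≤ n) (i : Fin n) (j : ℕ) (hj : 1 ≤ j) (hjn : j ≤ n) :
    ((Finset.univ.filter fun w : Fin n → Bool => cardAt n w i = j).card : ℝ) / 2 ^ n
      = a n (i.val + 1) j := by
  have hF : #{w : Fin n → Bool | cardAt n w i = j ∧ w i = false} =
      (i : ℕ).choose (j - 1) * 2 ^ (n - (i + 1)) := by
    have := card_filter_apply_eq_and_card_eq (s := Iio i) (p := i) (by simp) false (j - 1)
    rw [Fin.card_Iio, Fintype.card_fin] at this
    rw [← this]
    congr 1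
    ext w
    simp only [mem_filter, mem_univ, true_and]
    rw [and_comm]
    refine and_congr_right fun h => ?_
    rw [cardAt_of_eq_false h]
    omega
  have hT : #{w : Fin n → Bool | cardAt n w i = j ∧ ¬ w i = false} =
      if (i : ℕ) + 1 ≤ j then (n - (i + 1)).choose (j - (i + 1)) * 2 ^ (i : ℕ) else 0 := by
    split_ifs with hij
    · have := card_filter_apply_eq_and_card_eq (s := Ioi i) (p := i) (by simp) true (j - (i + 1))
      rw [Fin.card_Ioi, Fintype.card_fin, show n - (n - 1 - (i : ℕ) + 1) = i by omega,
        show n - 1 - (i : ℕ) = n - (i + 1) by omega] at this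
      rw [← this]
      congr 1
      ext w
      simp only [mem_filter, mem_univ, true_and, Bool.not_eq_false]
      rw [and_comm]
      refine and_congr_right fun h => ?_
      rw [cardAt_of_eq_true h]
      omega
    · rw [card_eq_zero, filter_eq_empty_iff]
      rintro w - ⟨hc, h⟩
      rw [cardAt_of_eq_true (by simpa using h)] at hc
      omega
  rw [← card_filter_add_card_filter_not (fun w : Fin n → Bool => w i = false),
    filter_filter, filter_filter, hF, hT, a]
  obtain ⟨m, hm⟩ : ∃ m, n = i + 1 + m := ⟨n - (i + 1), by omega⟩
  have hm' : n - ((i : ℕ) + 1) = m := by omega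
  have h2 : (2 : ℝ) ^ n = 2 ^ (i : ℕ) * 2 * 2 ^ m := by
    conv_lhs => rw [hm]
    rw [pow_add, pow_succ]
  rw [hm', h2, Nat.add_sub_cancel]
  split_ifs <;> push_cast <;> field_simp <;> ring
end

section
/- Fix integers n ≥ 1, 1 ≤ i ≤ n, and k ≥ 1, and for t = 1, …, 2^k define σ_t² = (n−i)·((t−1)/2^k)·(1 − (t−1)/2^k) + (i−1)·(t/2^k)·(1 − t/2^k). If i ≤ ⌊(n+1)/2⌋, then σ₁² ≤ σ_t² for all t = 1, …, 2^k; and if i ≥ ⌈(n+1)/2⌉, then σ_{2^k}² ≤ σ_t² for all t = 1, …, 2^k. Consequently, among the 2^k mixture components p_{L_1}, …, p_{L_{2^k}}, the component with the smallest variance (hence the highest peak) is p_{[1,1,…,1]} when i ≤ ⌊(n+1)/2⌋ and p_{[2,2,…,2]} otherwise. -/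
/-- `σ_t²`, the variance of `B₁ + B₂` with `B₁ ~ Binomial(n−i, (t−1)/2^k)` and
`B₂ ~ Binomial(i−1, t/2^k)` independent. -/
noncomputable def sigmaSq (n i k t : ℕ) : ℝ :=
  ((n : ℝ) - i) * (((t : ℝ) - 1) / 2 ^ k) * (1 - ((t : ℝ) - 1) / 2 ^ k) +
    ((i : ℝ) - 1) * ((t : ℝ) / 2 ^ k) * (1 - (t : ℝ) / 2 ^ k)

/-- The excess of `σ_t²` over `σ₁²` in factored form. -/
lemma sigmaSq_sub_sigmaSq_one (n i k t : ℕ) :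
    sigmaSq n i k t - sigmaSq n i k 1 =
      ((t : ℝ) - 1) * (((n : ℝ) - 1) * (2 ^ k - t) + (n + 1 - 2 * i)) / (2 ^ k) ^ 2 := by
  unfold sigmaSq
  push_cast
  field_simp
  ring

/-- The excess of `σ_t²` over `σ_{2^k}²` in factored form. -/
lemma sigmaSq_sub_sigmaSq_two_pow (n i k t : ℕ) :
    sigmaSq n i k t - sigmaSq n i k (2 ^ k) =
      ((2 : ℝ) ^ k - t) * (((n : ℝ) - 1) * (t - 1) + (2 * i - (n + 1))) / (2 ^ k) ^ 2 := by
  unfold sigmaSq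
  push_cast
  field_simp
  ring

/-- Among the `2^k` mixture components, the one with the smallest variance (hence
the highest peak) is `p_{[1,…,1]}` (i.e. `t = 1`) when `i ≤ ⌊(n+1)/2⌋`, and
`p_{[2,…,2]}` (i.e. `t = 2^k`) when `i ≥ ⌈(n+1)/2⌉`. -/
theorem smallest_variance (n i k : ℕ) (hn : 1 ≤ n) (hi : 1 ≤ i) (hin : i ≤ n)
    (hk : 1 ≤ k) :
    ∀ t : ℕ, 1 ≤ t → t ≤ 2 ^ k →
      (i ≤ (n + 1) / 2 → sigmaSq n i k 1 ≤ sigmaSq n i k t) ∧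
      ((n + 2) / 2 ≤ i → sigmaSq n i k (2 ^ k) ≤ sigmaSq n i k t) := by
  intro t ht htk
  have hn' : (0 : ℝ) ≤ n - 1 := sub_nonneg.2 (by exact_mod_cast hn)
  have ht' : (0 : ℝ) ≤ t - 1 := sub_nonneg.2 (by exact_mod_cast ht)
  have htk' : (0 : ℝ) ≤ 2 ^ k - t := sub_nonneg.2 (by exact_mod_cast htk)
  refine ⟨fun h => ?_, fun h => ?_⟩
  · have h' : (0 : ℝ) ≤ n + 1 - 2 * i :=
      sub_nonneg.2 (by exact_mod_cast (by omega : 2 * i ≤ n + 1))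
    rw [← sub_nonneg, sigmaSq_sub_sigmaSq_one]
    exact div_nonneg (mul_nonneg ht' (add_nonneg (mul_nonneg hn' htk') h')) (sq_nonneg _)
  · have h' : (0 : ℝ) ≤ 2 * i - (n + 1) :=
      sub_nonneg.2 (by exact_mod_cast (by omega : n + 1 ≤ 2 * i))
    rw [← sub_nonneg, sigmaSq_sub_sigmaSq_two_pow]
    exact div_nonneg (mul_nonneg htk' (add_nonneg (mul_nonneg hn' ht') h')) (sq_nonneg _)
end
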